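/- Asymptotic cumulants of a growing-noncentrality noncentral t statistic: Fix P > 0 and let A₁,…,A_n be i.i.d. standard normal random variables; define ρ = (A₁ + √(nP)) / √((1/(n−1))·∑_{i=2}^n A_i²), which has a noncentral t-distribution with n−1 degrees of freedom and noncentrality parameter √(nP). Then, as n → ∞: E[ρ] = √(nP) + (3/4)·√(P/n) + O(n^{-3/2}); Var(ρ) = (1 + P/2) + (2 + 19P/8)/n + O(n^{-3/2}); and the skewness Sk(ρ) = E[(ρ − E[ρ])³]/Var(ρ)^{3/2} satisfies Sk(ρ) = (12√P + 5P^{3/2})/(√(2n)·(2+P)^{3/2}) + O(n^{-3/2}); moreover the fourth cumulant of ρ is O(1/n). -/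

import Mathlib

open Filter MeasureTheory ProbabilityTheory Finset

noncomputable section

/-- The law of `n` i.i.d. standard normal random variables `A₁, …, A_n`. -/
def stdGaussPi (n : ℕ) : Measure (Fin n → ℝ) := Measure.pi fun _ => gaussianReal 0 1

/-- The noncentral t statistic `ρ = (A₁ + √(nP)) / √((1/(n−1))·∑_{i=2}^n A_i²)`,
which has a noncentral t-distribution with `n − 1` degrees of freedom and noncentrality
parameter `√(nP)`. -/
def rhoStat (P : ℝ) (n : ℕ) (a : Fin n → ℝ) : ℝ :=
  ((∑ i ∈ Finset.univ.filter fun i : Fin n => (i : ℕ) = 0, a i) + Real.sqrt ((n : ℝ) * P))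
    / Real.sqrt (((n : ℝ) - 1)⁻¹
        * ∑ i ∈ Finset.univ.filter fun i : Fin n => (i : ℕ) ≠ 0, a i ^ 2)

/-- `E[ρ]`. -/
def rhoMean (P : ℝ) (n : ℕ) : ℝ := ∫ a, rhoStat P n a ∂(stdGaussPi n)

/-- `E[(ρ − E[ρ])^k]`, the `k`-th central moment of `ρ`. -/
def rhoMom (P : ℝ) (n k : ℕ) : ℝ :=
  ∫ a, (rhoStat P n a - rhoMean P n) ^ k ∂(stdGaussPi n)

/-- The standard Gaussian product measure has the product of the Gaussian densities as density. -/
lemma stdGaussPi_eq_withDensity (m : ℕ) :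
    stdGaussPi m = (volume : Measure (Fin m → ℝ)).withDensity
      (fun x => ENNReal.ofReal (∏ i, gaussianPDFReal 0 1 (x i))) := by
  unfold stdGaussPi
  refine Measure.pi_eq (μ := fun _ : Fin m => gaussianReal 0 1) fun s hs => ?_
  have hint : ∀ i, Integrable (gaussianPDFReal 0 1) (volume.restrict (s i)) := fun i =>
    (integrable_gaussianPDFReal 0 1).restrict
  have hprod := integral_fintype_prod_eq_prod (𝕜 := ℝ)
    (μ := fun i : Fin m => (volume : Measure ℝ).restrict (s i))
    (fun (_ : Fin m) (x : ℝ) => gaussianPDFReal 0 1 x)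
  rw [withDensity_apply _ (MeasurableSet.univ_pi hs), volume_pi, Measure.restrict_pi_pi,
    ← ofReal_integral_eq_lintegral_ofReal (Integrable.fintype_prod hint)
      (Eventually.of_forall fun x => Finset.prod_nonneg fun i _ => gaussianPDFReal_nonneg 0 1 _),
    hprod, ENNReal.ofReal_prod_of_nonneg fun i _ =>
      integral_nonneg fun x => gaussianPDFReal_nonneg 0 1 x]
  exact Finset.prod_congr rfl fun i _ => (gaussianReal_apply_eq_integral 0 one_ne_zero (s i)).symm

lemma prod_gaussianPDFReal (m : ℕ) (x : EuclideanSpace ℝ (Fin m)) :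
    ∏ i, gaussianPDFReal 0 1 (x i)
      = (Real.sqrt (2 * Real.pi))⁻¹ ^ m * Real.exp (-(1 / 2) * ‖x‖ ^ 2) := by
  simp only [gaussianPDFReal, sub_zero, NNReal.coe_one, mul_one]
  rw [Finset.prod_mul_distrib, ← Real.exp_sum, EuclideanSpace.norm_sq_eq]
  simp only [prod_const, card_univ, Fintype.card_fin, Real.norm_eq_abs, sq_abs, Finset.mul_sum]
  congr 3
  ext i
  ring

/-- The Euclidean norm of a standard Gaussian vector has the chi distribution. -/
lemma stdGaussPi_norm (m : ℕ) (hm : 0 < m) : ∃ c : ℝ, ∀ g : ℝ → ℝ,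
    (Integrable (fun b => g (Real.sqrt (∑ i, b i ^ 2))) (stdGaussPi m) ↔
      IntegrableOn (fun y : ℝ => y ^ (m - 1) * (Real.exp (-(1 / 2) * y ^ 2) * g y)) (Set.Ioi 0)) ∧
    ∫ b, g (Real.sqrt (∑ i, b i ^ 2)) ∂(stdGaussPi m)
      = c * ∫ y in Set.Ioi (0 : ℝ), y ^ (m - 1) * (Real.exp (-(1 / 2) * y ^ 2) * g y) := by
  have : Nonempty (Fin m) := ⟨⟨0, hm⟩⟩
  set k := (Real.sqrt (2 * Real.pi))⁻¹ ^ m with hk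
  have hkpos : 0 < k := by positivity
  have hmeas : Measurable fun x : Fin m → ℝ =>
      ENNReal.ofReal (∏ i, gaussianPDFReal 0 1 (x i)) :=
    (Finset.measurable_prod _ fun i _ =>
      (measurable_gaussianPDFReal 0 1).comp (measurable_pi_apply i)).ennreal_ofReal
  have hlt : ∀ᵐ x : Fin m → ℝ, ENNReal.ofReal (∏ i, gaussianPDFReal 0 1 (x i)) < ⊤ :=
    Eventually.of_forall fun x => ENNReal.ofReal_lt_top
  have hmp := PiLp.volume_preserving_ofLp (Fin m)
  have hemb : MeasurableEmbedding (@WithLp.ofLp 2 (Fin m → ℝ)) :=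
    (MeasurableEquiv.toLp 2 (Fin m → ℝ)).symm.measurableEmbedding
  have key : ∀ (g : ℝ → ℝ) (x : EuclideanSpace ℝ (Fin m)),
      (ENNReal.ofReal (∏ i, gaussianPDFReal 0 1 (x.ofLp i))).toReal
        • g (Real.sqrt (∑ i, x.ofLp i ^ 2))
      = k * (Real.exp (-(1 / 2) * ‖x‖ ^ 2) * g ‖x‖) := by
    intro g x
    rw [prod_gaussianPDFReal, ENNReal.toReal_ofReal (by positivity), EuclideanSpace.norm_eq]
    simp [mul_assoc, hk]
  refine ⟨k * (m * (volume : Measure (EuclideanSpace ℝ (Fin m))).real (Metric.ball 0 1)),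
    fun g => ⟨?_, ?_⟩⟩
  · rw [stdGaussPi_eq_withDensity, integrable_withDensity_iff_integrable_smul' hmeas hlt,
      ← hmp.integrable_comp_emb hemb]
    simp only [Function.comp_def, key]
    rw [integrable_const_mul_iff hkpos.ne'.isUnit]
    have := integrable_fun_norm_addHaar (volume : Measure (EuclideanSpace ℝ (Fin m)))
      (f := fun y => Real.exp (-(1 / 2) * y ^ 2) * g y)
    simpa using this
  · rw [stdGaussPi_eq_withDensity, integral_withDensity_eq_integral_toReal_smul hmeas hlt,
      ← hmp.integral_comp hemb]
    simp only [key]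
    rw [integral_const_mul]
    have := integral_fun_norm_addHaar (volume : Measure (EuclideanSpace ℝ (Fin m)))
      (f := fun y => Real.exp (-(1 / 2) * y ^ 2) * g y)
    rw [this]
    simp [mul_assoc]

instance (m : ℕ) : IsProbabilityMeasure (stdGaussPi m) := by
  unfold stdGaussPi; infer_instance

/-- Moments of the chi distribution with `m` degrees of freedom. -/
lemma stdGaussPi_norm_rpow (m : ℕ) (hm : 0 < m) (p : ℝ) (hp : 0 < m + p) :
    Integrable (fun b => Real.sqrt (∑ i, b i ^ 2) ^ p) (stdGaussPi m) ∧
    ∫ b, Real.sqrt (∑ i, b i ^ 2) ^ p ∂(stdGaussPi m)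
      = 2 ^ (p / 2) * Real.Gamma ((m + p) / 2) / Real.Gamma (m / 2) := by
  obtain ⟨c, hc⟩ := stdGaussPi_norm m hm
  have hexp : ∀ q : ℝ, ∀ y ∈ Set.Ioi (0 : ℝ),
      y ^ (m + q - 1) * Real.exp (-(1 / 2) * y ^ (2 : ℝ)) =
        y ^ (m - 1) * (Real.exp (-(1 / 2) * y ^ 2) * y ^ q) := by
    intro q y hy
    have hy : 0 < y := hy
    rw [← Real.rpow_natCast y (m - 1), Nat.cast_pred hm, Real.rpow_two,
      show (m : ℝ) + q - 1 = (m - 1) + q by ring, Real.rpow_add hy]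
    ring
  have hval : ∀ q : ℝ, 0 < m + q →
      ∫ y in Set.Ioi (0 : ℝ), y ^ (m - 1) * (Real.exp (-(1 / 2) * y ^ 2) * y ^ q)
        = (1 / 2) ^ (-((m + q) / 2)) * (1 / 2) * Real.Gamma ((m + q) / 2) := by
    intro q hq
    rw [← setIntegral_congr_fun measurableSet_Ioi (hexp q),
      integral_rpow_mul_exp_neg_mul_rpow two_pos (by linarith) (by norm_num)]
    congr 3 <;> ring_nf
  have hone : 1 = c * ((1 / 2) ^ (-((m : ℝ) / 2)) * (1 / 2) * Real.Gamma (m / 2)) := by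
    have := hval 0 (by simpa using hm)
    rw [add_zero] at this
    rw [← this, ← (hc _).2]
    simp
  have hm' : (0 : ℝ) < m := by exact_mod_cast hm
  have hG := Real.Gamma_pos_of_pos (half_pos hm')
  constructor
  · rw [(hc fun y => y ^ p).1, ← integrableOn_congr_fun (hexp p) measurableSet_Ioi]
    exact integrableOn_rpow_mul_exp_neg_mul_rpow (by linarith) two_pos (by norm_num)
  · rw [(hc fun y => y ^ p).2, hval p hp, eq_div_iff hG.ne']
    have h2 : (1 / 2 : ℝ) ^ (-((m + p) / 2)) = (1 / 2) ^ (-((m : ℝ) / 2)) * 2 ^ (p / 2) := by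
      rw [show -((m + p) / 2) = -((m : ℝ) / 2) + -(p / 2) by ring,
        Real.rpow_add (by norm_num), one_div, Real.inv_rpow (by norm_num) (-(p / 2)),
        Real.rpow_neg (by norm_num) (p / 2), inv_inv]
    rw [h2]
    linear_combination (-(2 ^ (p / 2) * Real.Gamma ((m + p) / 2))) * hone

lemma integrable_pow_gaussianReal (k : ℕ) : Integrable (fun x : ℝ => x ^ k) (gaussianReal 0 1) :=
  (memLp_id_gaussianReal' (k : ENNReal) (by simp)).integrable_norm_pow' |>.mono'
    (by fun_prop) (Eventually.of_forall fun x => by simp)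

lemma integral_sq_gaussianReal : ∫ x, x ^ 2 ∂(gaussianReal 0 1) = 1 := by
  have h := variance_fun_id_gaussianReal (μ := 0) (v := 1)
  rw [variance_eq_integral (by fun_prop), integral_id_gaussianReal] at h
  simpa using h

lemma integral_cube_gaussianReal : ∫ x, x ^ 3 ∂(gaussianReal 0 1) = 0 := by
  have h : ∫ x, x ^ 3 ∂(gaussianReal 0 1) = ∫ x, (-x) ^ 3 ∂(gaussianReal 0 1) := by
    conv_lhs => rw [← neg_zero, ← gaussianReal_map_neg]
    rw [integral_map (by fun_prop) (by fun_prop)]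
  simp only [Odd.neg_pow (by decide : Odd 3), integral_neg] at h
  linarith

lemma integral_pow_four_gaussianReal : ∫ x, x ^ 4 ∂(gaussianReal 0 1) = 3 := by
  have h := (stdGaussPi_norm_rpow 1 one_pos 4 (by norm_num)).2
  have hpi := integral_fintype_prod_eq_prod (𝕜 := ℝ) (μ := fun _ : Fin 1 => gaussianReal 0 1)
    (fun (_ : Fin 1) (x : ℝ) => x ^ 4)
  simp only [univ_unique, prod_singleton] at hpi
  rw [← hpi]
  have hnorm : ∀ b : Fin 1 → ℝ, Real.sqrt (∑ i, b i ^ 2) ^ (4 : ℝ) = b default ^ 4 := by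
    intro b
    rw [show (4 : ℝ) = ((4 : ℕ) : ℝ) by norm_num, Real.rpow_natCast]
    simp only [univ_unique, sum_singleton, Real.sqrt_sq_eq_abs]
    exact Even.pow_abs (by decide) _
  simp only [hnorm] at h
  refine h.trans ?_
  rw [show (((1 : ℕ) : ℝ) + 4) / 2 = (1 / 2 + 1) + 1 by norm_num,
    Real.Gamma_add_one (by norm_num), Real.Gamma_add_one (by norm_num), Nat.cast_one]
  have := Real.Gamma_pos_of_pos (show (0 : ℝ) < 1 / 2 by norm_num)
  rw [show (4 : ℝ) / 2 = (2 : ℕ) by norm_num, Real.rpow_natCast]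
  field_simp
  norm_num

/-- The mean of `√(m / χ²)` for a chi-squared variable with `m` degrees of freedom. -/
def invChiMean (m : ℕ) : ℝ :=
  Real.sqrt m * (2 ^ (-(1 : ℝ) / 2) * Real.Gamma ((m - 1) / 2) / Real.Gamma (m / 2))

lemma stdGaussPi_norm_inv_pow (m k : ℕ) (hk : k < m) :
    Integrable (fun b => (Real.sqrt m * (Real.sqrt (∑ i, b i ^ 2))⁻¹) ^ k) (stdGaussPi m) ∧
    ∫ b, (Real.sqrt m * (Real.sqrt (∑ i, b i ^ 2))⁻¹) ^ k ∂(stdGaussPi m)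
      = Real.sqrt m ^ k *
        (2 ^ (-(k : ℝ) / 2) * Real.Gamma ((m - k) / 2) / Real.Gamma (m / 2)) := by
  have hk' : (k : ℝ) < m := by exact_mod_cast hk
  obtain ⟨h₁, h₂⟩ := stdGaussPi_norm_rpow m (by omega) (-k) (by linarith)
  have hfun : ∀ b : Fin m → ℝ, (Real.sqrt m * (Real.sqrt (∑ i, b i ^ 2))⁻¹) ^ k
      = Real.sqrt m ^ k * Real.sqrt (∑ i, b i ^ 2) ^ (-(k : ℝ)) := by
    intro b
    rw [mul_pow, Real.rpow_neg (Real.sqrt_nonneg _), Real.rpow_natCast, inv_pow]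
  simp only [hfun]
  refine ⟨h₁.const_mul _, ?_⟩
  rw [integral_const_mul, h₂]
  ring_nf

lemma Gamma_half_eq {t : ℝ} (ht : 2 < t) :
    Real.Gamma (t / 2) = (t - 2) / 2 * Real.Gamma ((t - 2) / 2) := by
  rw [← Real.Gamma_add_one (by linarith)]
  ring_nf

lemma invChi_moment_one (m : ℕ) (hm : 4 < m) :
    ∫ b, (Real.sqrt m * (Real.sqrt (∑ i, b i ^ 2))⁻¹) ^ 1 ∂(stdGaussPi m) = invChiMean m := by
  rw [(stdGaussPi_norm_inv_pow m 1 (by omega)).2, invChiMean]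
  simp

lemma invChi_moment_two (m : ℕ) (hm : 4 < m) :
    ∫ b, (Real.sqrt m * (Real.sqrt (∑ i, b i ^ 2))⁻¹) ^ 2 ∂(stdGaussPi m) = m / (m - 2) := by
  have hm' : (4 : ℝ) < m := by exact_mod_cast hm
  rw [(stdGaussPi_norm_inv_pow m 2 (by omega)).2, Gamma_half_eq (t := m) (by linarith),
    Real.sq_sqrt (by positivity)]
  have := Real.Gamma_pos_of_pos (show (0 : ℝ) < (m - 2) / 2 by linarith)
  have h2 : (m : ℝ) - 2 ≠ 0 := by linarith
  rw [show -((2 : ℕ) : ℝ) / 2 = -(1 : ℕ) by norm_num, Real.rpow_neg (by norm_num),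
    Real.rpow_natCast]
  push_cast
  field_simp

lemma invChi_moment_three (m : ℕ) (hm : 4 < m) :
    ∫ b, (Real.sqrt m * (Real.sqrt (∑ i, b i ^ 2))⁻¹) ^ 3 ∂(stdGaussPi m)
      = invChiMean m * (m / (m - 3)) := by
  have hm' : (4 : ℝ) < m := by exact_mod_cast hm
  rw [(stdGaussPi_norm_inv_pow m 3 (by omega)).2, invChiMean,
    Gamma_half_eq (t := m - 1) (by linarith)]
  have := Real.Gamma_pos_of_pos (show (0 : ℝ) < m / 2 by linarith)
  have h3 : (m : ℝ) - 3 ≠ 0 := by linarith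
  rw [show -((3 : ℕ) : ℝ) / 2 = -(1 : ℝ) / 2 + -(1 : ℕ) by norm_num,
    Real.rpow_add (by norm_num), Real.rpow_neg (by norm_num) ((1 : ℕ) : ℝ),
    Real.rpow_natCast, pow_succ (Real.sqrt (m : ℝ)) 2, Real.sq_sqrt (by positivity)]
  rw [show (m : ℝ) - 1 - 2 = m - 3 by ring]
  push_cast
  field_simp

lemma invChi_moment_four (m : ℕ) (hm : 4 < m) :
    ∫ b, (Real.sqrt m * (Real.sqrt (∑ i, b i ^ 2))⁻¹) ^ 4 ∂(stdGaussPi m)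
      = m ^ 2 / ((m - 2) * (m - 4)) := by
  have hm' : (4 : ℝ) < m := by exact_mod_cast hm
  rw [(stdGaussPi_norm_inv_pow m 4 (by omega)).2, Gamma_half_eq (t := m) (by linarith),
    Gamma_half_eq (t := m - 2) (by linarith), show (m : ℝ) - 2 - 2 = m - 4 by ring,
    pow_mul (Real.sqrt (m : ℝ)) 2 2, Real.sq_sqrt (by positivity)]
  have := Real.Gamma_pos_of_pos (show (0 : ℝ) < (m - 4) / 2 by linarith)
  have h2 : (m : ℝ) - 2 ≠ 0 := by linarith
  have h4 : (m : ℝ) - 4 ≠ 0 := by linarith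
  rw [show -((4 : ℕ) : ℝ) / 2 = -(2 : ℕ) by norm_num, Real.rpow_neg (by norm_num),
    Real.rpow_natCast]
  push_cast
  field_simp

lemma rhoStat_succ (P : ℝ) (m : ℕ) (a : Fin (m + 1) → ℝ) :
    rhoStat P (m + 1) a = (a 0 + Real.sqrt (((m : ℝ) + 1) * P))
      * (Real.sqrt m * (Real.sqrt (∑ i : Fin m, a i.succ ^ 2))⁻¹) := by
  have h₀ : ∑ i ∈ Finset.univ.filter (fun i : Fin (m + 1) => (i : ℕ) = 0), a i = a 0 := by
    rw [Finset.sum_filter, Fin.sum_univ_succ]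
    simp
  have h₁ : ∑ i ∈ Finset.univ.filter (fun i : Fin (m + 1) => (i : ℕ) ≠ 0), a i ^ 2
      = ∑ i : Fin m, a i.succ ^ 2 := by
    rw [Finset.sum_filter, Fin.sum_univ_succ]
    simp
  rw [rhoStat, h₀, h₁]
  push_cast
  rw [add_sub_cancel_right, Real.sqrt_mul (by positivity : (0 : ℝ) ≤ (m : ℝ)⁻¹), Real.sqrt_inv,
    div_eq_mul_inv, mul_inv,
    inv_inv]

lemma rhoStat_pow (P : ℝ) (m k : ℕ) (hk : k < m) :
    Integrable (fun a => rhoStat P (m + 1) a ^ k) (stdGaussPi (m + 1)) ∧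
    ∫ a, rhoStat P (m + 1) a ^ k ∂(stdGaussPi (m + 1))
      = (∫ x, (x + Real.sqrt (((m : ℝ) + 1) * P)) ^ k ∂(gaussianReal 0 1))
        * ∫ b, (Real.sqrt m * (Real.sqrt (∑ i, b i ^ 2))⁻¹) ^ k ∂(stdGaussPi m) := by
  have hmp := measurePreserving_piFinSuccAbove (fun _ : Fin (m + 1) => gaussianReal 0 1) 0
  have hemb := (MeasurableEquiv.piFinSuccAbove (fun _ : Fin (m + 1) => ℝ) 0).measurableEmbedding
  set f : ℝ → ℝ := fun x => (x + Real.sqrt (((m : ℝ) + 1) * P)) ^ k with hf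
  set g : (Fin m → ℝ) → ℝ := fun b => (Real.sqrt m * (Real.sqrt (∑ i, b i ^ 2))⁻¹) ^ k with hg
  have hcomp : (fun a => rhoStat P (m + 1) a ^ k)
      = (fun z : ℝ × (Fin m → ℝ) => f z.1 * g z.2)
        ∘ (MeasurableEquiv.piFinSuccAbove (fun _ : Fin (m + 1) => ℝ) 0) := by
    funext a
    simp [rhoStat_succ, mul_pow, hf, hg, Fin.tail]
  have hfi : Integrable f (gaussianReal 0 1) := by
    simp only [hf, add_pow]
    exact integrable_finsetSum _ fun i _ =>
      ((integrable_pow_gaussianReal i).mul_const _).mul_const _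
  have hgi : Integrable g (stdGaussPi m) := (stdGaussPi_norm_inv_pow m k hk).1
  constructor
  · rw [hcomp]
    exact (hmp.integrable_comp_emb hemb).2 (hfi.mul_prod hgi)
  · rw [hcomp]
    exact (hmp.integral_comp hemb _).trans (integral_prod_mul f g)

lemma integral_add_const_pow_gaussianReal (d : ℝ) :
    (∫ x, (x + d) ^ 1 ∂(gaussianReal 0 1) = d) ∧
    (∫ x, (x + d) ^ 2 ∂(gaussianReal 0 1) = d ^ 2 + 1) ∧
    (∫ x, (x + d) ^ 3 ∂(gaussianReal 0 1) = d ^ 3 + 3 * d) ∧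
    (∫ x, (x + d) ^ 4 ∂(gaussianReal 0 1) = d ^ 4 + 6 * d ^ 2 + 3) := by
  have hint : ∀ k i : ℕ, Integrable
      (fun x : ℝ => x ^ i * d ^ (k - i) * (k.choose i : ℝ)) (gaussianReal 0 1) := fun k i =>
    ((integrable_pow_gaussianReal i).mul_const _).mul_const _
  have hsum : ∀ k : ℕ, ∫ x, (x + d) ^ k ∂(gaussianReal 0 1)
      = ∑ i ∈ range (k + 1), (∫ x, x ^ i ∂(gaussianReal 0 1)) * d ^ (k - i) * (k.choose i : ℝ) := by
    intro k
    simp only [add_pow]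
    rw [integral_finsetSum _ fun i _ => hint k i]
    simp only [integral_mul_const]
  have h1 := integral_id_gaussianReal (μ := 0) (v := 1)
  have h2 := integral_sq_gaussianReal
  have h3 := integral_cube_gaussianReal
  have h4 := integral_pow_four_gaussianReal
  refine ⟨?_, ?_, ?_, ?_⟩ <;> rw [hsum] <;>
    simp [Finset.sum_range_succ, h1, h2, h3, h4, Nat.choose] <;> ring

lemma rhoMom_eq_sum (P : ℝ) (m k : ℕ) (hk : k < m) :
    rhoMom P (m + 1) k = ∑ i ∈ range (k + 1), (∫ a, rhoStat P (m + 1) a ^ i ∂(stdGaussPi (m + 1)))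
      * (-rhoMean P (m + 1)) ^ (k - i) * (k.choose i : ℝ) := by
  simp only [rhoMom, sub_eq_add_neg, add_pow]
  rw [integral_finsetSum]
  · simp only [integral_mul_const]
  · intro i hi
    have : i < k + 1 := Finset.mem_range.1 hi
    exact ((rhoStat_pow P m i (by omega)).1.mul_const _).mul_const _

/-- Closed forms of the mean and of the central moments of the noncentral t statistic. -/
lemma rho_closed_forms (P : ℝ) (m : ℕ) (hm : 4 < m) :
    let d := Real.sqrt (((m : ℝ) + 1) * P)
    let w := invChiMean m
    rhoMean P (m + 1) = d * w ∧
    rhoMom P (m + 1) 2 = (d ^ 2 + 1) * (m / (m - 2)) - (d * w) ^ 2 ∧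
    rhoMom P (m + 1) 3 = (d ^ 3 + 3 * d) * (w * (m / (m - 3)))
      - 3 * (d * w) * ((d ^ 2 + 1) * (m / (m - 2))) + 2 * (d * w) ^ 3 ∧
    rhoMom P (m + 1) 4 = (d ^ 4 + 6 * d ^ 2 + 3) * (m ^ 2 / ((m - 2) * (m - 4)))
      - 4 * (d * w) * ((d ^ 3 + 3 * d) * (w * (m / (m - 3))))
      + 6 * (d * w) ^ 2 * ((d ^ 2 + 1) * (m / (m - 2))) - 3 * (d * w) ^ 4 := by
  intro d w
  obtain ⟨g1, g2, g3, g4⟩ := integral_add_const_pow_gaussianReal d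
  have r1 : ∫ a, rhoStat P (m + 1) a ∂(stdGaussPi (m + 1)) = d * w := by
    have := (rhoStat_pow P m 1 (by omega)).2
    rw [g1, invChi_moment_one m hm] at this
    simpa using this
  have r2 := (rhoStat_pow P m 2 (by omega)).2
  have r3 := (rhoStat_pow P m 3 (by omega)).2
  have r4 := (rhoStat_pow P m 4 (by omega)).2
  rw [g2, invChi_moment_two m hm] at r2
  rw [g3, invChi_moment_three m hm] at r3
  rw [g4, invChi_moment_four m hm] at r4
  have hmean : rhoMean P (m + 1) = d * w := r1
  refine ⟨hmean, ?_, ?_, ?_⟩ <;> rw [rhoMom_eq_sum _ _ _ (by omega), hmean] <;>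
    simp only [Finset.sum_range_succ, Finset.sum_range_zero, pow_one, r1, r2, r3, r4] <;>
    simp [Nat.choose] <;> ring

lemma invChiMean_sq (m : ℕ) : invChiMean m ^ 2
    = m / 2 * (Real.Gamma ((m - 1) / 2) / Real.Gamma (m / 2)) ^ 2 := by
  have h : ((2 : ℝ) ^ (-(1 : ℝ) / 2)) ^ 2 = 1 / 2 := by
    rw [← Real.rpow_natCast, ← Real.rpow_mul (by norm_num)]
    norm_num
  rw [invChiMean, mul_pow, Real.sq_sqrt (by positivity), mul_div_assoc, mul_pow, h]
  ring

lemma invChiMean_nonneg (m : ℕ) (hm : 1 < m) : 0 ≤ invChiMean m := by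
  have hm' : (1 : ℝ) < m := by exact_mod_cast hm
  have h₁ := Real.Gamma_pos_of_pos (show (0 : ℝ) < (m - 1) / 2 by linarith)
  have h₂ := Real.Gamma_pos_of_pos (show (0 : ℝ) < m / 2 by linarith)
  unfold invChiMean
  positivity

lemma invChiMean_sq_add_two (m : ℕ) (hm : 1 < m) : invChiMean (m + 2) ^ 2
    = (m + 2) * (m - 1) ^ 2 / m ^ 3 * invChiMean m ^ 2 := by
  have hm' : (1 : ℝ) < m := by exact_mod_cast hm
  have h₂ := Real.Gamma_pos_of_pos (show (0 : ℝ) < m / 2 by linarith)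
  rw [invChiMean_sq, invChiMean_sq, Gamma_half_eq (t := ((m + 2 : ℕ) : ℝ) - 1)
    (by push_cast; linarith), Gamma_half_eq (t := ((m + 2 : ℕ) : ℝ)) (by push_cast; linarith)]
  push_cast
  rw [show (m : ℝ) + 2 - 1 - 2 = m - 1 by ring, add_sub_cancel_right]
  field_simp

lemma Gamma_add_half_sq_le {t : ℝ} (ht : 0 < t) :
    Real.Gamma (t + 1 / 2) ^ 2 ≤ t * Real.Gamma t ^ 2 := by
  have h := Real.Gamma_mul_add_mul_le_rpow_Gamma_mul_rpow_Gamma ht (add_pos ht one_pos)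
    (show (0 : ℝ) < 1 / 2 by norm_num) (show (0 : ℝ) < 1 / 2 by norm_num) (by norm_num)
  rw [show 1 / 2 * t + 1 / 2 * (t + 1) = t + 1 / 2 by ring, ← Real.sqrt_eq_rpow,
    ← Real.sqrt_eq_rpow, Real.Gamma_add_one ht.ne'] at h
  have hG := Real.Gamma_pos_of_pos ht
  have hG' := Real.Gamma_pos_of_pos (show 0 < t + 1 / 2 by linarith)
  calc Real.Gamma (t + 1 / 2) ^ 2
      ≤ (Real.sqrt (Real.Gamma t) * Real.sqrt (t * Real.Gamma t)) ^ 2 := by gcongr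
    _ = t * Real.Gamma t ^ 2 := by
      rw [mul_pow, Real.sq_sqrt hG.le, Real.sq_sqrt (by positivity)]
      ring

lemma invChiMean_sq_bounds (m : ℕ) (hm : 2 < m) :
    (m : ℝ) / (m - 1) ≤ invChiMean m ^ 2 ∧ invChiMean m ^ 2 ≤ m / (m - 2) := by
  have hm' : (2 : ℝ) < m := by exact_mod_cast hm
  have h₁ := Real.Gamma_pos_of_pos (show (0 : ℝ) < (m - 1) / 2 by linarith)
  have h₂ := Real.Gamma_pos_of_pos (show (0 : ℝ) < m / 2 by linarith)
  have h₃ := Gamma_add_half_sq_le (show (0 : ℝ) < (m - 1) / 2 by linarith)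
  have h₄ := Gamma_add_half_sq_le (show (0 : ℝ) < (m - 2) / 2 by linarith)
  have hrec := Gamma_half_eq (t := (m : ℝ)) hm'
  have hG := Real.Gamma_pos_of_pos (show (0 : ℝ) < (m - 2) / 2 by linarith)
  rw [show ((m : ℝ) - 1) / 2 + 1 / 2 = m / 2 by ring] at h₃
  rw [show ((m : ℝ) - 2) / 2 + 1 / 2 = (m - 1) / 2 by ring] at h₄
  have hpos : (0 : ℝ) < m - 2 := by linarith
  have hpos' : (0 : ℝ) < m - 1 := by linarith
  rw [invChiMean_sq, div_pow, ← mul_div_assoc]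
  constructor
  · rw [div_le_div_iff₀ hpos' (by positivity)]
    have := mul_le_mul_of_nonneg_left h₃ (show (0 : ℝ) ≤ m by linarith)
    linarith
  · rw [div_le_div_iff₀ (by positivity) hpos, hrec]
    have := mul_le_mul_of_nonneg_left h₄ (show (0 : ℝ) ≤ m / 2 * (m - 2) by positivity)
    nlinarith

/-- The second-order expansion of `invChiMean m ^ 2`, with third coefficient `K`. -/
def invChiApprox (K t : ℝ) : ℝ := 1 + 3 / (2 * t) + 17 / (8 * t ^ 2) + K / t ^ 3

lemma invChiApprox_add_two_le {t : ℝ} (ht : 5 ≤ t) :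
    invChiApprox 10 (t + 2) ≤ (t + 2) * (t - 1) ^ 2 / t ^ 3 * invChiApprox 10 t := by
  obtain ⟨s, hs, rfl⟩ : ∃ s, 0 ≤ s ∧ t = s + 5 := ⟨t - 5, by linarith, by ring⟩
  rw [← sub_nonneg]
  have h : (s + 5 + 2) * (s + 5 - 1) ^ 2 / (s + 5) ^ 3 * invChiApprox 10 (s + 5)
      - invChiApprox 10 (s + 5 + 2)
      = (345 * s ^ 5 + 8921 * s ^ 4 + 91250 * s ^ 3 + 460122 * s ^ 2 + 1140117 * s + 1107565)
        / (8 * (s + 5) ^ 6 * (s + 5 + 2) ^ 3) := by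
    have h₁ : s + 5 ≠ 0 := by positivity
    have h₂ : s + 5 + 2 ≠ 0 := by positivity
    unfold invChiApprox
    field_simp
    ring
  rw [h]
  positivity

lemma le_invChiApprox_add_two {t : ℝ} (ht : 5 ≤ t) :
    (t + 2) * (t - 1) ^ 2 / t ^ 3 * invChiApprox (-10) t ≤ invChiApprox (-10) (t + 2) := by
  obtain ⟨s, hs, rfl⟩ : ∃ s, 0 ≤ s ∧ t = s + 5 := ⟨t - 5, by linarith, by ring⟩
  rw [← sub_nonneg]
  have h : invChiApprox (-10) (s + 5 + 2)
      - (s + 5 + 2) * (s + 5 - 1) ^ 2 / (s + 5) ^ 3 * invChiApprox (-10) (s + 5)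
      = (615 * s ^ 5 + 16519 * s ^ 4 + 176270 * s ^ 3 + 932838 * s ^ 2 + 2445483 * s + 2538995)
        / (8 * (s + 5) ^ 6 * (s + 5 + 2) ^ 3) := by
    have h₁ : s + 5 ≠ 0 := by positivity
    have h₂ : s + 5 + 2 ≠ 0 := by positivity
    unfold invChiApprox
    field_simp
    ring
  rw [h]
  positivity

lemma invChiApprox_pos {K t : ℝ} (hK : -10 ≤ K) (ht : 5 ≤ t) : 0 < invChiApprox K t := by
  have h₀ : 0 < t := by linarith
  have h : -(10 / 125) ≤ K / t ^ 3 := by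
    rw [le_div_iff₀ (by positivity)]
    have : (5 : ℝ) ^ 3 ≤ t ^ 3 := by gcongr
    linarith
  have h₁ : 0 < 3 / (2 * t) := by positivity
  have h₂ : 0 < 17 / (8 * t ^ 2) := by positivity
  unfold invChiApprox
  linarith

lemma tendsto_invChiApprox (K : ℝ) : Tendsto (fun m : ℕ => invChiApprox K m) atTop (nhds 1) := by
  have h : Tendsto (fun m : ℕ => ((m : ℝ))⁻¹) atTop (nhds 0) := tendsto_inv_atTop_nhds_zero_nat
  have := ((((h.const_mul (3 / 2)).const_add 1).add ((h.pow 2).const_mul (17 / 8))).add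
    ((h.pow 3).const_mul K))
  norm_num at this
  refine this.congr fun m => ?_
  rw [invChiApprox]
  ring

lemma tendsto_invChiMean_sq : Tendsto (fun m : ℕ => invChiMean m ^ 2) atTop (nhds 1) := by
  have h : Tendsto (fun m : ℕ => ((m : ℝ))⁻¹) atTop (nhds 0) := tendsto_inv_atTop_nhds_zero_nat
  have key : ∀ k : ℝ, k ≤ 2 → Tendsto (fun m : ℕ => (m : ℝ) / (m - k)) atTop (nhds 1) := by
    intro k hk
    have := ((h.const_mul k).const_sub 1).inv₀ (by simp)
    norm_num at this
    refine this.congr' ?_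
    filter_upwards [eventually_gt_atTop 2] with m hm
    have hm' : (2 : ℝ) < m := by exact_mod_cast hm
    have : (m : ℝ) - k ≠ 0 := by linarith
    field_simp
  refine tendsto_of_tendsto_of_tendsto_of_le_of_le' (key 1 (by norm_num)) (key 2 le_rfl) ?_ ?_ <;>
    filter_upwards [eventually_gt_atTop 2] with m hm
  exacts [(invChiMean_sq_bounds m hm).1, (invChiMean_sq_bounds m hm).2]

lemma abs_invChiMean_sq_sub_le (m : ℕ) (hm : 5 ≤ m) :
    |invChiMean m ^ 2 - (1 + 3 / (2 * m) + 17 / (8 * (m : ℝ) ^ 2))| ≤ 10 / (m : ℝ) ^ 3 := by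
  have hcast : ∀ j : ℕ, (5 : ℝ) ≤ ((m + 2 * j : ℕ) : ℝ) := fun j => by
    exact_mod_cast (by omega : 5 ≤ m + 2 * j)
  have hsub : Tendsto (fun j : ℕ => m + 2 * j) atTop atTop :=
    tendsto_atTop_mono (fun j => (by omega : j ≤ m + 2 * j)) tendsto_id
  have hlim : ∀ K, Tendsto (fun j : ℕ => invChiMean (m + 2 * j) ^ 2
      / invChiApprox K ((m + 2 * j : ℕ) : ℝ)) atTop (nhds 1) := by
    intro K
    have := (tendsto_invChiMean_sq.comp hsub).div ((tendsto_invChiApprox K).comp hsub) one_ne_zero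
    rwa [div_one] at this
  have hrec : ∀ j : ℕ, invChiMean (m + 2 * (j + 1)) ^ 2
      = (((m + 2 * j : ℕ) : ℝ) + 2) * (((m + 2 * j : ℕ) : ℝ) - 1) ^ 2 / ((m + 2 * j : ℕ) : ℝ) ^ 3
        * invChiMean (m + 2 * j) ^ 2 := fun j => invChiMean_sq_add_two (m + 2 * j) (by omega)
  have hnext : ∀ j : ℕ, ((m + 2 * (j + 1) : ℕ) : ℝ) = ((m + 2 * j : ℕ) : ℝ) + 2 := fun j => by
    push_cast; ring
  have hup : Monotone fun j : ℕ => invChiMean (m + 2 * j) ^ 2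
      / invChiApprox 10 ((m + 2 * j : ℕ) : ℝ) := by
    refine monotone_nat_of_le_succ fun j => ?_
    rw [hrec, hnext, div_le_div_iff₀ (invChiApprox_pos (by norm_num) (hcast j))
      (invChiApprox_pos (by norm_num) (by linarith [hcast j]))]
    have := mul_le_mul_of_nonneg_left (invChiApprox_add_two_le (hcast j))
      (sq_nonneg (invChiMean (m + 2 * j)))
    linarith
  have hdown : Antitone fun j : ℕ => invChiMean (m + 2 * j) ^ 2
      / invChiApprox (-10) ((m + 2 * j : ℕ) : ℝ) := by
    refine antitone_nat_of_succ_le fun j => ?_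
    rw [hrec, hnext, div_le_div_iff₀ (invChiApprox_pos (by norm_num) (by linarith [hcast j]))
      (invChiApprox_pos (by norm_num) (hcast j))]
    have := mul_le_mul_of_nonneg_left (le_invChiApprox_add_two (hcast j))
      (sq_nonneg (invChiMean (m + 2 * j)))
    linarith
  have h₁ := hup.ge_of_tendsto (hlim 10) 0
  have h₂ := hdown.le_of_tendsto (hlim (-10)) 0
  have h₅ : (5 : ℝ) ≤ m := by exact_mod_cast hm
  simp only [mul_zero, add_zero] at h₁ h₂
  rw [div_le_one (invChiApprox_pos (by norm_num) h₅), invChiApprox] at h₁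
  rw [one_le_div (invChiApprox_pos (by norm_num) h₅), invChiApprox, neg_div] at h₂
  rw [abs_le]
  constructor <;> linarith

/-- A real sequence is eventually bounded. -/
def EventuallyBounded (f : ℕ → ℝ) : Prop := ∃ C : ℝ, ∀ᶠ n in atTop, |f n| ≤ C

namespace EventuallyBounded

lemma const (c : ℝ) : EventuallyBounded fun _ => c := ⟨|c|, Eventually.of_forall fun _ => le_rfl⟩

lemma add {f g : ℕ → ℝ} (hf : EventuallyBounded f) (hg : EventuallyBounded g) :
    EventuallyBounded fun n => f n + g n := by
  obtain ⟨C, hC⟩ := hf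
  obtain ⟨D, hD⟩ := hg
  refine ⟨C + D, ?_⟩
  filter_upwards [hC, hD] with n h₁ h₂
  exact (abs_add_le _ _).trans (add_le_add h₁ h₂)

lemma mul {f g : ℕ → ℝ} (hf : EventuallyBounded f) (hg : EventuallyBounded g) :
    EventuallyBounded fun n => f n * g n := by
  obtain ⟨C, hC⟩ := hf
  obtain ⟨D, hD⟩ := hg
  refine ⟨C * D, ?_⟩
  filter_upwards [hC, hD] with n h₁ h₂
  rw [abs_mul]
  exact mul_le_mul h₁ h₂ (abs_nonneg _) ((abs_nonneg _).trans h₁)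

lemma sub {f g : ℕ → ℝ} (hf : EventuallyBounded f) (hg : EventuallyBounded g) :
    EventuallyBounded fun n => f n - g n := by
  simpa [sub_eq_add_neg] using hf.add ((const (-1)).mul hg)

lemma pow {f : ℕ → ℝ} (hf : EventuallyBounded f) (k : ℕ) :
    EventuallyBounded fun n => f n ^ k := by
  induction k with
  | zero => simpa using const 1
  | succ k ih => simpa [pow_succ] using ih.mul hf

lemma of_tendsto {f : ℕ → ℝ} {a : ℝ} (hf : Tendsto f atTop (nhds a)) : EventuallyBounded f := by
  refine ⟨|a| + 1, ?_⟩
  filter_upwards [hf.abs.eventually (gt_mem_nhds (lt_add_one |a|))] with n hn using hn.le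

lemma exists_bound {f F g : ℕ → ℝ} (hf : EventuallyBounded f)
    (h : ∀ᶠ n in atTop, F n = g n * f n) (hg : ∀ n, 0 ≤ g n) :
    ∃ C : ℝ, ∀ᶠ n in atTop, |F n| ≤ C * g n := by
  obtain ⟨C, hC⟩ := hf
  refine ⟨C, ?_⟩
  filter_upwards [hC, h] with n h₁ h₂
  rw [h₂, abs_mul, abs_of_nonneg (hg n), mul_comm]
  exact mul_le_mul_of_nonneg_right h₁ (hg n)

lemma tendsto_mul {f x : ℕ → ℝ} (hf : EventuallyBounded f) (hx : Tendsto x atTop (nhds 0)) :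
    Tendsto (fun n => x n * f n) atTop (nhds 0) := by
  obtain ⟨C, hC⟩ := hf
  refine squeeze_zero_norm' (a := fun n => |x n| * C) ?_ (by simpa using hx.abs.mul_const C)
  filter_upwards [hC] with n hn
  rw [Real.norm_eq_abs, abs_mul]
  gcongr

/-- A differentiable function preserves first-order expansions. -/
lemma comp_hasDerivAt {f x : ℕ → ℝ} (hf : EventuallyBounded f) (hx : Tendsto x atTop (nhds 0))
    (hx₀ : ∀ᶠ n in atTop, x n ≠ 0) {φ : ℝ → ℝ} {c φ' : ℝ} (hφ : HasDerivAt φ φ' c) :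
    EventuallyBounded fun n => (φ (c + x n * f n) - φ c) / x n := by
  have hlim : Tendsto (fun n => c + x n * f n) atTop (nhds c) := by
    simpa using (hf.tendsto_mul hx).const_add c
  obtain ⟨K, hK⟩ := (hφ.isBigO_sub.comp_tendsto hlim).bound
  obtain ⟨C, hC⟩ := hf
  refine ⟨|K| * C, ?_⟩
  filter_upwards [hK, hC, hx₀] with n h₁ h₂ h₃
  simp only [Function.comp_apply, Real.norm_eq_abs, add_sub_cancel_left, abs_mul] at h₁
  rw [abs_div, div_le_iff₀ (abs_pos.2 h₃)]
  calc |φ (c + x n * f n) - φ c| ≤ K * (|x n| * |f n|) := h₁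
    _ ≤ |K| * (|x n| * C) := by gcongr; exact le_abs_self K
    _ = |K| * C * |x n| := by ring

end EventuallyBounded

lemma tendsto_natCast_inv : Tendsto (fun n : ℕ => (n : ℝ)⁻¹) atTop (nhds 0) :=
  tendsto_inv_atTop_nhds_zero_nat

lemma eventuallyBounded_inv_one_sub (k : ℝ) :
    EventuallyBounded fun n => (1 - k * (n : ℝ)⁻¹)⁻¹ := by
  have := ((tendsto_natCast_inv.const_mul k).const_sub 1).inv₀ (by simp)
  exact EventuallyBounded.of_tendsto this

/-- The expansion of the squared mean of `√((n - 1) / χ²)`, with `n - 1` degrees of freedom, in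
powers of `1 / n`. -/
lemma exists_invChiMean_sq_expansion : ∃ η : ℕ → ℝ, EventuallyBounded η ∧ ∀ᶠ n : ℕ in atTop,
    invChiMean (n - 1) ^ 2
      = 1 + 3 / 2 * (n : ℝ)⁻¹ + 29 / 8 * (n : ℝ)⁻¹ ^ 2 + (n : ℝ)⁻¹ ^ 3 * η n := by
  have hb := eventuallyBounded_inv_one_sub 1
  have he : EventuallyBounded fun n : ℕ => (invChiMean (n - 1) ^ 2
      - (1 + 3 / (2 * ((n : ℝ) - 1)) + 17 / (8 * ((n : ℝ) - 1) ^ 2))) * (n : ℝ) ^ 3 := by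
    obtain ⟨C, hC⟩ := (hb.pow 3).mul (EventuallyBounded.const 10)
    refine ⟨C, ?_⟩
    filter_upwards [hC, eventually_ge_atTop 6] with n h₁ hn
    have h := abs_invChiMean_sq_sub_le (n - 1) (by omega)
    rw [Nat.cast_pred (by omega)] at h
    have hn' : (6 : ℝ) ≤ n := by exact_mod_cast hn
    have h₂ : (n : ℝ) ≠ 0 := by linarith
    have h₃ : 0 < (n : ℝ) - 1 := by linarith
    rw [abs_mul, abs_of_nonneg (by positivity : (0 : ℝ) ≤ (n : ℝ) ^ 3)]
    refine (mul_le_mul_of_nonneg_right h (by positivity)).trans (le_trans (le_of_eq ?_)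
      ((le_abs_self _).trans h₁))
    have h₄ : (1 : ℝ) - 1 * (n : ℝ)⁻¹ = (n - 1) / n := by field_simp
    rw [h₄, inv_div]
    field_simp
  have hx := EventuallyBounded.of_tendsto tendsto_natCast_inv
  refine ⟨fun n => 3 / 2 * (1 - 1 * (n : ℝ)⁻¹)⁻¹
    + 17 / 8 * ((2 - (n : ℝ)⁻¹) * (1 - 1 * (n : ℝ)⁻¹)⁻¹ ^ 2) + (invChiMean (n - 1) ^ 2
      - (1 + 3 / (2 * ((n : ℝ) - 1)) + 17 / (8 * ((n : ℝ) - 1) ^ 2))) * (n : ℝ) ^ 3,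
    ((((EventuallyBounded.const _).mul hb).add ((EventuallyBounded.const _).mul
      (((EventuallyBounded.const _).sub hx).mul (hb.pow 2)))).add he), ?_⟩
  filter_upwards [eventually_ge_atTop 6] with n hn
  have hn' : (6 : ℝ) ≤ n := by exact_mod_cast hn
  have h₂ : (n : ℝ) ≠ 0 := by linarith
  have h₃ : (n : ℝ) - 1 ≠ 0 := by linarith
  have h₄ : (1 : ℝ) - 1 * (n : ℝ)⁻¹ = (n - 1) / n := by field_simp
  rw [h₄]
  generalize invChiMean (n - 1) ^ 2 = q
  field_simp
  ring

lemma exists_rational_expansions : ∃ U V W : ℕ → ℝ,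
    EventuallyBounded U ∧ EventuallyBounded V ∧ EventuallyBounded W ∧ ∀ᶠ n : ℕ in atTop,
      ((n : ℝ) - 1) / ((n : ℝ) - 1 - 2)
        = 1 + 2 * (n : ℝ)⁻¹ + 6 * (n : ℝ)⁻¹ ^ 2 + (n : ℝ)⁻¹ ^ 3 * U n ∧
      ((n : ℝ) - 1) / ((n : ℝ) - 1 - 3)
        = 1 + 3 * (n : ℝ)⁻¹ + 12 * (n : ℝ)⁻¹ ^ 2 + (n : ℝ)⁻¹ ^ 3 * V n ∧
      ((n : ℝ) - 1) ^ 2 / (((n : ℝ) - 1 - 2) * ((n : ℝ) - 1 - 4))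
        = 1 + 6 * (n : ℝ)⁻¹ + 34 * (n : ℝ)⁻¹ ^ 2 + (n : ℝ)⁻¹ ^ 3 * W n := by
  have hx := EventuallyBounded.of_tendsto tendsto_natCast_inv
  have h₃ := eventuallyBounded_inv_one_sub 3
  have h₄ := eventuallyBounded_inv_one_sub 4
  have h₅ := eventuallyBounded_inv_one_sub 5
  refine ⟨fun n => 18 * (1 - 3 * (n : ℝ)⁻¹)⁻¹, fun n => 48 * (1 - 4 * (n : ℝ)⁻¹)⁻¹,
    fun n => (182 - 510 * (n : ℝ)⁻¹) * ((1 - 3 * (n : ℝ)⁻¹)⁻¹ * (1 - 5 * (n : ℝ)⁻¹)⁻¹),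
    (EventuallyBounded.const _).mul h₃, (EventuallyBounded.const _).mul h₄,
    ((EventuallyBounded.const _).sub ((EventuallyBounded.const _).mul hx)).mul (h₃.mul h₅), ?_⟩
  filter_upwards [eventually_ge_atTop 6] with n hn
  have hn' : (6 : ℝ) ≤ n := by exact_mod_cast hn
  have e : (n : ℝ) ≠ 0 := by linarith
  have e₃ : (n : ℝ) - 3 ≠ 0 := by linarith
  have e₄ : (n : ℝ) - 4 ≠ 0 := by linarith
  have e₅ : (n : ℝ) - 5 ≠ 0 := by linarith
  have i : ∀ k : ℝ, 1 - k * (n : ℝ)⁻¹ = (n - k) / n := fun k => by field_simp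
  rw [i 3, i 4, i 5, show (n : ℝ) - 1 - 2 = n - 3 by ring, show (n : ℝ) - 1 - 3 = n - 4 by ring,
    show (n : ℝ) - 1 - 4 = n - 5 by ring]
  refine ⟨?_, ?_, ?_⟩ <;> field_simp <;> ring

lemma rpow_neg_three_halves (n : ℕ) :
    (n : ℝ) ^ (-(3 : ℝ) / 2) = (Real.sqrt n)⁻¹ ^ 3 := by
  rw [Real.sqrt_eq_rpow, inv_pow, ← Real.rpow_natCast, ← Real.rpow_mul (by positivity),
    ← Real.rpow_neg (by positivity)]
  norm_num

lemma rpow_three_halves {t : ℝ} (ht : 0 ≤ t) : t ^ ((3 : ℝ) / 2) = t * Real.sqrt t := by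
  rw [Real.sqrt_eq_rpow, ← Real.rpow_one_add' ht (by norm_num)]
  norm_num

/-- The closed forms of the mean and central moments in terms of the mean `w` of `√((n-1)/χ²)`. -/
lemma rho_closed_forms_pred (P : ℝ) (hP : 0 < P) (n : ℕ) (hn : 6 ≤ n) :
    let w := invChiMean (n - 1)
    let D := (n : ℝ) * P
    let u := ((n : ℝ) - 1) / ((n : ℝ) - 1 - 2)
    let v := ((n : ℝ) - 1) / ((n : ℝ) - 1 - 3)
    let y := ((n : ℝ) - 1) ^ 2 / (((n : ℝ) - 1 - 2) * ((n : ℝ) - 1 - 4))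
    rhoMean P n = Real.sqrt D * w ∧
    rhoMom P n 2 = (D + 1) * u - D * w ^ 2 ∧
    rhoMom P n 3 = Real.sqrt D * w * ((D + 3) * v - 3 * (D + 1) * u + 2 * D * w ^ 2) ∧
    rhoMom P n 4 = (D ^ 2 + 6 * D + 3) * y - 4 * (D ^ 2 + 3 * D) * w ^ 2 * v
      + 6 * D * (D + 1) * w ^ 2 * u - 3 * D ^ 2 * (w ^ 2) ^ 2 := by
  obtain ⟨m, rfl⟩ : ∃ m, n = m + 1 := ⟨n - 1, by omega⟩
  have h := rho_closed_forms P m (by omega)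
  intro w D u v y
  have hD : ((m + 1 : ℕ) : ℝ) * P = ((m : ℝ) + 1) * P := by push_cast; ring
  have hm : ((m + 1 : ℕ) : ℝ) - 1 = m := by push_cast; ring
  simp only [w, D, u, v, y, hm, hD, Nat.add_sub_cancel]
  have hs : Real.sqrt (((m : ℝ) + 1) * P) ^ 2 = ((m : ℝ) + 1) * P :=
    Real.sq_sqrt (by positivity)
  simp only at h
  set d := Real.sqrt (((m : ℝ) + 1) * P)
  rw [← hs]
  obtain ⟨h₁, h₂, h₃, h₄⟩ := h
  refine ⟨h₁, ?_, ?_, ?_⟩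
  · rw [h₂]; ring
  · rw [h₃]; ring
  · rw [h₄]; ring

lemma exists_invChiMean_expansion : ∃ ω : ℕ → ℝ, EventuallyBounded ω ∧ ∀ᶠ n : ℕ in atTop,
    invChiMean (n - 1) = 1 + 3 / 4 * (n : ℝ)⁻¹ + (n : ℝ)⁻¹ ^ 2 * ω n := by
  obtain ⟨η, hη, hq⟩ := exists_invChiMean_sq_expansion
  have hx := EventuallyBounded.of_tendsto tendsto_natCast_inv
  have hden : EventuallyBounded fun n : ℕ =>
      (invChiMean (n - 1) + (1 + 3 / 4 * (n : ℝ)⁻¹))⁻¹ := by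
    refine ⟨1, ?_⟩
    filter_upwards [eventually_ge_atTop 6] with n hn
    have h₁ := invChiMean_nonneg (n - 1) (by omega)
    have h₂ : 0 ≤ 3 / 4 * (n : ℝ)⁻¹ := by positivity
    rw [abs_of_nonneg (by positivity)]
    exact inv_le_one_of_one_le₀ (by linarith)
  refine ⟨fun n => (49 / 16 + (n : ℝ)⁻¹ * η n)
    * (invChiMean (n - 1) + (1 + 3 / 4 * (n : ℝ)⁻¹))⁻¹,
    ((EventuallyBounded.const _).add (hx.mul hη)).mul hden, ?_⟩
  filter_upwards [hq, eventually_ge_atTop 6] with n hn hn6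
  have h₁ := invChiMean_nonneg (n - 1) (by omega)
  have h₂ : 0 ≤ 3 / 4 * (n : ℝ)⁻¹ := by positivity
  have h₃ : invChiMean (n - 1) + (1 + 3 / 4 * (n : ℝ)⁻¹) ≠ 0 := by positivity
  generalize invChiMean (n - 1) = w at *
  generalize (n : ℝ)⁻¹ = x at *
  rw [← sub_eq_iff_eq_add', ← mul_assoc, ← div_eq_mul_inv, eq_div_iff h₃]
  linear_combination hn

/-- Expansions of the mean, the central moments and the fourth cumulant in powers of `1 / n`. -/
lemma exists_rho_expansions (P : ℝ) (hP : 0 < P) : ∃ ω B₂ B₃ B₄ : ℕ → ℝ,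
    EventuallyBounded ω ∧ EventuallyBounded B₂ ∧ EventuallyBounded B₃ ∧ EventuallyBounded B₄ ∧
    ∀ᶠ n : ℕ in atTop,
      rhoMean P n = Real.sqrt (n * P) * (1 + 3 / 4 * (n : ℝ)⁻¹ + (n : ℝ)⁻¹ ^ 2 * ω n) ∧
      rhoMom P n 2 = 1 + P / 2 + (n : ℝ)⁻¹ * (2 + 19 * P / 8) + (n : ℝ)⁻¹ ^ 2 * B₂ n ∧
      rhoMom P n 3 = Real.sqrt (n * P) * (1 + 3 / 4 * (n : ℝ)⁻¹ + (n : ℝ)⁻¹ ^ 2 * ω n)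
        * ((n : ℝ)⁻¹ * (5 * P / 4 + 3) + (n : ℝ)⁻¹ ^ 2 * B₃ n) ∧
      rhoMom P n 4 - 3 * rhoMom P n 2 ^ 2 = (n : ℝ)⁻¹ * B₄ n := by
  obtain ⟨η, hη, hq⟩ := exists_invChiMean_sq_expansion
  obtain ⟨ω, hω, hw⟩ := exists_invChiMean_expansion
  obtain ⟨U, V, W, hU, hV, hW, huvw⟩ := exists_rational_expansions
  have hx := EventuallyBounded.of_tendsto tendsto_natCast_inv
  refine ⟨ω, fun n => 6 + (n : ℝ)⁻¹ * U n + P * (U n - η n),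
    fun n => P * (V n - 3 * U n + 2 * η n) + (18 + 3 * (n : ℝ)⁻¹ * (V n - U n)),
    fun n => P ^ 2 * (-(231 / 4) - 3195 / 32 * (n : ℝ)⁻¹ + W n
        - 4 * ((1 + 3 / 2 * (n : ℝ)⁻¹ + 29 / 8 * (n : ℝ)⁻¹ ^ 2) * V n
          + (1 + 3 * (n : ℝ)⁻¹ + 12 * (n : ℝ)⁻¹ ^ 2) * η n + (n : ℝ)⁻¹ ^ 3 * η n * V n)
        + 12 * ((1 + 3 / 2 * (n : ℝ)⁻¹ + 29 / 8 * (n : ℝ)⁻¹ ^ 2) * U n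
          + (1 + 2 * (n : ℝ)⁻¹ + 6 * (n : ℝ)⁻¹ ^ 2) * η n + (n : ℝ)⁻¹ ^ 3 * η n * U n)
        - 6 * (2 * (1 + 3 / 2 * (n : ℝ)⁻¹ + 29 / 8 * (n : ℝ)⁻¹ ^ 2) * η n
          + (n : ℝ)⁻¹ ^ 3 * η n ^ 2)
        - 3 * (2 * (1 + 2 * (n : ℝ)⁻¹ + 6 * (n : ℝ)⁻¹ ^ 2) * U n + (n : ℝ)⁻¹ ^ 3 * U n ^ 2))
      + P * (6 * (34 + (n : ℝ)⁻¹ * W n) + 12 * (6 + (n : ℝ)⁻¹ * U n - (12 + (n : ℝ)⁻¹ * V n))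
        + 12 * (3 / 2 + (n : ℝ)⁻¹ * (29 / 8 + (n : ℝ)⁻¹ * η n))
          * (-1 + (n : ℝ)⁻¹ * (6 + (n : ℝ)⁻¹ * U n - (12 + (n : ℝ)⁻¹ * V n)))
        - 12 * (6 + (n : ℝ)⁻¹ * U n) - 6 * (2 + (n : ℝ)⁻¹ * (6 + (n : ℝ)⁻¹ * U n)) ^ 2)
      + 3 * (6 + (n : ℝ)⁻¹ * (34 + (n : ℝ)⁻¹ * W n)
        - 2 * (2 + (n : ℝ)⁻¹ * (6 + (n : ℝ)⁻¹ * U n))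
        - (n : ℝ)⁻¹ * (2 + (n : ℝ)⁻¹ * (6 + (n : ℝ)⁻¹ * U n)) ^ 2), hω, ?_, ?_, ?_, ?_⟩
  · repeat' first
      | assumption
      | exact EventuallyBounded.const _
      | apply EventuallyBounded.sub
      | apply EventuallyBounded.add
      | apply EventuallyBounded.mul
  · repeat' first
      | assumption
      | exact EventuallyBounded.const _
      | apply EventuallyBounded.sub
      | apply EventuallyBounded.add
      | apply EventuallyBounded.mul
  · repeat' first
      | assumption
      | exact EventuallyBounded.const _
      | apply EventuallyBounded.sub
      | apply EventuallyBounded.add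
      | apply EventuallyBounded.mul
  filter_upwards [hq, hw, huvw, eventually_ge_atTop 6] with n hqn hwn ⟨hu, hv, hy⟩ hn
  obtain ⟨h₁, h₂, h₃, h₄⟩ := rho_closed_forms_pred P hP n hn
  have hn₀ : (n : ℝ) ≠ 0 := by positivity
  rw [hu, hqn] at h₂
  rw [hu, hv, hqn, hwn] at h₃
  rw [hu, hv, hy, hqn] at h₄
  refine ⟨by rw [h₁, hwn], ?_, ?_, ?_⟩
  · rw [h₂]
    field_simp
    ring
  · rw [h₃]
    field_simp
    ring
  · rw [h₄, h₂]
    field_simp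
    ring

/-- asymptotic cumulants of a growing-noncentrality noncentral t
statistic. -/
theorem noncentral_t_cumulants (P : ℝ) (hP : 0 < P) :
    -- mean expansion
    (∃ C : ℝ, ∀ᶠ n : ℕ in atTop,
      |rhoMean P n - (Real.sqrt ((n : ℝ) * P) + 3 / 4 * Real.sqrt (P / n))|
        ≤ C * (n : ℝ) ^ (-(3 : ℝ) / 2)) ∧
    -- variance expansion
    (∃ C : ℝ, ∀ᶠ n : ℕ in atTop,
      |rhoMom P n 2 - ((1 + P / 2) + (2 + 19 * P / 8) / n)| ≤ C * (n : ℝ) ^ (-(3 : ℝ) / 2)) ∧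
    -- skewness expansion
    (∃ C : ℝ, ∀ᶠ n : ℕ in atTop,
      |rhoMom P n 3 / rhoMom P n 2 ^ ((3 : ℝ) / 2)
          - (12 * Real.sqrt P + 5 * P ^ ((3 : ℝ) / 2))
            / (Real.sqrt (2 * n) * (2 + P) ^ ((3 : ℝ) / 2))|
        ≤ C * (n : ℝ) ^ (-(3 : ℝ) / 2)) ∧
    -- the fourth cumulant is O(1/n)
    (∃ C : ℝ, ∀ᶠ n : ℕ in atTop,
      |rhoMom P n 4 - 3 * rhoMom P n 2 ^ 2| ≤ C / n) := by
  obtain ⟨ω, B₂, B₃, B₄, hω, hB₂, hB₃, hB₄, hexp⟩ := exists_rho_expansions P hP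
  have hx := EventuallyBounded.of_tendsto tendsto_natCast_inv
  have hsqrt : Tendsto (fun n : ℕ => (Real.sqrt n)⁻¹) atTop (nhds 0) := by
    simpa using tendsto_natCast_inv.sqrt
  have hs := EventuallyBounded.of_tendsto hsqrt
  have hx₀ : ∀ᶠ n : ℕ in atTop, (n : ℝ)⁻¹ ≠ 0 := by
    filter_upwards [eventually_gt_atTop 0] with n hn
    positivity
  have hmain : ∀ n : ℕ, 0 < n → (Real.sqrt n)⁻¹ ≠ 0 ∧ (n : ℝ)⁻¹ = (Real.sqrt n)⁻¹ ^ 2 ∧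
      Real.sqrt (n * P) = Real.sqrt P / (Real.sqrt n)⁻¹ := by
    intro n hn
    refine ⟨by positivity, ?_, ?_⟩
    · rw [inv_pow, Real.sq_sqrt (by positivity)]
    · rw [Real.sqrt_mul (by positivity), div_inv_eq_mul, mul_comm]
  have hnonneg : ∀ n : ℕ, (0 : ℝ) ≤ (n : ℝ) ^ (-(3 : ℝ) / 2) := fun n => by positivity
  refine ⟨?_, ?_, ?_, ?_⟩
  · refine ((EventuallyBounded.const (Real.sqrt P)).mul hω).exists_bound ?_ hnonneg
    filter_upwards [hexp, eventually_gt_atTop 0] with n ⟨h₁, _, _, _⟩ hn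
    obtain ⟨e₁, e₂, e₃⟩ := hmain n hn
    rw [h₁, rpow_neg_three_halves, Real.sqrt_div hP.le, div_eq_mul_inv (Real.sqrt P), e₃, e₂]
    field_simp
    ring
  · refine (hs.mul hB₂).exists_bound ?_ hnonneg
    filter_upwards [hexp, eventually_gt_atTop 0] with n ⟨_, h₂, _, _⟩ hn
    obtain ⟨e₁, e₂, e₃⟩ := hmain n hn
    rw [h₂, rpow_neg_three_halves, div_eq_mul_inv _ (n : ℝ), e₂]
    ring
  · have hc : 0 < 1 + P / 2 := by positivity
    have hφ : HasDerivAt (fun t : ℝ => t ^ (-(3 : ℝ) / 2))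
        (-(3 : ℝ) / 2 * (1 + P / 2) ^ (-(3 : ℝ) / 2 - 1)) (1 + P / 2) :=
      Real.hasDerivAt_rpow_const (Or.inl hc.ne')
    have hV : EventuallyBounded fun n : ℕ => 2 + 19 * P / 8 + (n : ℝ)⁻¹ * B₂ n :=
      (EventuallyBounded.const _).add (hx.mul hB₂)
    have hR := hV.comp_hasDerivAt tendsto_natCast_inv hx₀ hφ
    have hpos : ∀ᶠ n : ℕ in atTop,
        0 < 1 + P / 2 + (n : ℝ)⁻¹ * (2 + 19 * P / 8 + (n : ℝ)⁻¹ * B₂ n) := by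
      have := (hV.tendsto_mul tendsto_natCast_inv).const_add (1 + P / 2)
      rw [add_zero] at this
      exact this.eventually (lt_mem_nhds hc)
    set R : ℕ → ℝ := fun n => ((1 + P / 2 + (n : ℝ)⁻¹ * (2 + 19 * P / 8 + (n : ℝ)⁻¹ * B₂ n))
      ^ (-(3 : ℝ) / 2) - (1 + P / 2) ^ (-(3 : ℝ) / 2)) / (n : ℝ)⁻¹ with hRdef
    set c' := (1 + P / 2) ^ (-(3 : ℝ) / 2) with hc'
    have hW : EventuallyBounded fun n : ℕ => 3 / 4 + (n : ℝ)⁻¹ * ω n :=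
      (EventuallyBounded.const _).add (hx.mul hω)
    have hK : EventuallyBounded fun n : ℕ => 5 * P / 4 + 3 + (n : ℝ)⁻¹ * B₃ n :=
      (EventuallyBounded.const _).add (hx.mul hB₃)
    have hC : EventuallyBounded fun n : ℕ => c' + (n : ℝ)⁻¹ * R n :=
      (EventuallyBounded.const _).add (hx.mul hR)
    refine ((EventuallyBounded.const (Real.sqrt P)).mul (((hW.mul (hK.mul hC)).add
      (hB₃.mul hC)).add ((EventuallyBounded.const (5 * P / 4 + 3)).mul hR))).exists_bound
      ?_ hnonneg
    filter_upwards [hexp, eventually_gt_atTop 0, hpos, hx₀] with n ⟨_, h₂, h₃, _⟩ hn hn₁ hn₂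
    obtain ⟨e₁, e₂, e₃⟩ := hmain n hn
    have h₂' : rhoMom P n 2
        = 1 + P / 2 + (n : ℝ)⁻¹ * (2 + 19 * P / 8 + (n : ℝ)⁻¹ * B₂ n) := by
      rw [h₂]; ring
    have hinv : (rhoMom P n 2 ^ ((3 : ℝ) / 2))⁻¹ = c' + (n : ℝ)⁻¹ * R n := by
      rw [h₂', ← Real.rpow_neg hn₁.le, ← neg_div, hRdef]
      field_simp
      ring
    have htarget : (12 * Real.sqrt P + 5 * P ^ ((3 : ℝ) / 2))
        / (Real.sqrt (2 * n) * (2 + P) ^ ((3 : ℝ) / 2))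
        = Real.sqrt P * (Real.sqrt n)⁻¹ * (5 * P / 4 + 3) * c' := by
      have h2P : (2 + P) ^ ((3 : ℝ) / 2)
          = 2 * Real.sqrt 2 * (1 + P / 2) ^ ((3 : ℝ) / 2) := by
        rw [show 2 + P = 2 * (1 + P / 2) by ring, Real.mul_rpow (by norm_num) hc.le,
          rpow_three_halves (by norm_num : (0 : ℝ) ≤ 2)]
      have hcpos : 0 < (1 + P / 2) ^ ((3 : ℝ) / 2) := by positivity
      have h2 : Real.sqrt 2 * Real.sqrt 2 = 2 := Real.mul_self_sqrt (by norm_num)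
      have h4 : Real.sqrt 2 * Real.sqrt n * (2 * Real.sqrt 2 * (1 + P / 2) ^ ((3 : ℝ) / 2))
          = 4 * Real.sqrt n * (1 + P / 2) ^ ((3 : ℝ) / 2) := by
        linear_combination (2 * Real.sqrt n * (1 + P / 2) ^ ((3 : ℝ) / 2)) * h2
      rw [hc', neg_div, Real.rpow_neg hc.le, h2P, rpow_three_halves hP.le,
        Real.sqrt_mul (by norm_num), h4]
      have hn0 : Real.sqrt n ≠ 0 := by positivity
      field_simp
      ring
    rw [htarget, div_eq_mul_inv (rhoMom P n 3), hinv, h₃, rpow_neg_three_halves, e₃, e₂]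
    generalize R n = r
    field_simp
    ring
  · obtain ⟨C, hC⟩ := hB₄.exists_bound (F := fun n => rhoMom P n 4 - 3 * rhoMom P n 2 ^ 2)
      (g := fun n : ℕ => (n : ℝ)⁻¹) (hexp.mono fun n h => h.2.2.2) fun n => by positivity
    exact ⟨C, by simpa only [div_eq_mul_inv] using hC⟩
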